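/- Let R be a commutative ring, v, w ∈ R, let E be a matrix factorization of v over R and F a matrix factorization of w over R, and let p be a prime ideal of R with v ∈ p and w ∈ p. Then p ∈ Supp(E ⊗ F) if and only if p ∈ Supp(E) and p ∈ Supp(F), where E ⊗ F is a matrix factorization of v + w over R. -/

import Mathlib

open Matrix Kronecker

structure MF (R : Type) [CommRing R] : Type 1 where
  ι1 : Type
  ι0 : Type
  [fin1 : Fintype ι1]
  [fin0 : Fintype ι0]
  [dec1 : DecidableEq ι1]
  [dec0 : DecidableEq ι0]
  A : Matrix ι0 ι1 R
  B : Matrix ι1 ι0 R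

attribute [instance] MF.fin1 MF.fin0 MF.dec1 MF.dec0

namespace MF

variable {R S : Type} [CommRing R] [CommRing S]

def IsMF (w : R) (F : MF R) : Prop :=
  F.B * F.A = w • (1 : Matrix F.ι1 F.ι1 R) ∧ F.A * F.B = w • (1 : Matrix F.ι0 F.ι0 R)

def Contractible (F : MF R) : Prop :=
  ∃ (h0 : Matrix F.ι1 F.ι0 R) (h1 : Matrix F.ι0 F.ι1 R),
    (1 : Matrix F.ι0 F.ι0 R) = F.A * h0 + h1 * F.B ∧
    (1 : Matrix F.ι1 F.ι1 R) = F.B * h1 + h0 * F.A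

def map (f : R →+* S) (F : MF R) : MF S where
  ι1 := F.ι1
  ι0 := F.ι0
  A := F.A.map f
  B := F.B.map f

def Supp (F : MF R) : Set (PrimeSpectrum R) :=
  { p | ¬ Contractible (F.map (algebraMap R (Localization.AtPrime p.asIdeal))) }

/-- The tensor product of two matrix factorizations (of `v` and `w`), a matrix
factorization of `v + w`, with `(E⊗F)₁ = (E₁⊗F₀) ⊕ (E₀⊗F₁)`,
`(E⊗F)₀ = (E₀⊗F₀) ⊕ (E₁⊗F₁)` and the usual sign conventions. -/
def tensor (E F : MF R) : MF R where
  ι1 := (E.ι1 × F.ι0) ⊕ (E.ι0 × F.ι1)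
  ι0 := (E.ι0 × F.ι0) ⊕ (E.ι1 × F.ι1)
  A := Matrix.fromBlocks
        (E.A ⊗ₖ (1 : Matrix F.ι0 F.ι0 R)) ((1 : Matrix E.ι0 E.ι0 R) ⊗ₖ F.A)
        (-((1 : Matrix E.ι1 E.ι1 R) ⊗ₖ F.B)) (E.B ⊗ₖ (1 : Matrix F.ι1 F.ι1 R))
  B := Matrix.fromBlocks
        (E.B ⊗ₖ (1 : Matrix F.ι0 F.ι0 R)) (-((1 : Matrix E.ι1 E.ι1 R) ⊗ₖ F.A))
        ((1 : Matrix E.ι0 E.ι0 R) ⊗ₖ F.B) (E.A ⊗ₖ (1 : Matrix F.ι1 F.ι1 R))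

/-- A morphism of matrix factorizations, given by the two component matrices
`f1 : E₁ → F₁` and `f0 : E₀ → F₀`. -/
structure Hom (E F : MF R) : Type where
  f1 : Matrix F.ι1 E.ι1 R
  f0 : Matrix F.ι0 E.ι0 R

/-- The pair `(f1, f0)` commutes with the structure maps. -/
def Hom.IsHom {E F : MF R} (f : Hom E F) : Prop :=
  f.f0 * E.A = F.A * f.f1 ∧ f.f1 * E.B = F.B * f.f0

/-- Null-homotopic morphisms of matrix factorizations. -/
def Hom.NullHomotopic {E F : MF R} (f : Hom E F) : Prop :=
  ∃ (h0 : Matrix F.ι1 E.ι0 R) (h1 : Matrix F.ι0 E.ι1 R),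
    f.f0 = F.A * h0 + h1 * E.B ∧ f.f1 = F.B * h1 + h0 * E.A

/-- Base change of a morphism of matrix factorizations. -/
def Hom.map (φ : R →+* S) {E F : MF R} (f : Hom E F) : Hom (E.map φ) (F.map φ) where
  f1 := f.f1.map φ
  f0 := f.f0.map φ

/-- The identity morphism. -/
def Hom.id (F : MF R) : Hom F F where
  f1 := 1
  f0 := 1

/-- Composition of morphisms. -/
def Hom.comp {E F G : MF R} (g : Hom F G) (f : Hom E F) : Hom E G where
  f1 := g.f1 * f.f1
  f0 := g.f0 * f.f0

/-- Two morphisms are homotopic if their difference is null-homotopic. -/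
def Hom.Homotopic {E F : MF R} (f g : Hom E F) : Prop :=
  Hom.NullHomotopic (⟨f.f1 - g.f1, f.f0 - g.f0⟩ : Hom E F)

/-- The tensor product of two morphisms of matrix factorizations. -/
def Hom.tensor {E E' F F' : MF R} (f : Hom E E') (g : Hom F F') :
    Hom (E.tensor F) (E'.tensor F') where
  f1 := Matrix.fromBlocks (f.f1 ⊗ₖ g.f0) 0 0 (f.f0 ⊗ₖ g.f1)
  f0 := Matrix.fromBlocks (f.f0 ⊗ₖ g.f0) 0 0 (f.f1 ⊗ₖ g.f1)

/-- `pow1 E n` is the `(n+1)`-fold tensor power `E^{⊗(n+1)}`. -/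
def pow1 (E : MF R) : ℕ → MF R
  | 0 => E
  | n + 1 => (pow1 E n).tensor E

/-- `Hom.pow1 f n` is the `(n+1)`-fold tensor power `f^{⊗(n+1)}` of a morphism. -/
def Hom.pow1 {E F : MF R} (f : Hom E F) : (n : ℕ) → Hom (E.pow1 n) (F.pow1 n)
  | 0 => f
  | n + 1 => (Hom.pow1 f n).tensor f

end MF

namespace MF

section Maps

variable {R S : Type} [CommRing R] [CommRing S]

lemma map_tensor (f : R →+* S) (E F : MF R) :
    (E.tensor F).map f = (E.map f).tensor (F.map f) := by
  have hneg {m n : Type} (M : Matrix m n R) : (-M).map f = -M.map f := by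
    ext; simp
  have hkron {l m n o : Type} (M : Matrix l m R) (N : Matrix n o R) :
      (M ⊗ₖ N).map f = M.map f ⊗ₖ N.map f := by
    ext; simp
  have hone {n : Type} [DecidableEq n] : (1 : Matrix n n R).map f = 1 :=
    Matrix.map_one f (map_zero f) (map_one f)
  simp only [tensor, map, fromBlocks_map, hneg, hkron, hone]
  rfl

lemma contractible_map_iff {F : MF R} {f : R →+* S} :
    (F.map f).Contractible ↔ ∃ (h0 : Matrix F.ι1 F.ι0 S) (h1 : Matrix F.ι0 F.ι1 S),
      (1 : Matrix F.ι0 F.ι0 S) = F.A.map f * h0 + h1 * F.B.map f ∧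
      (1 : Matrix F.ι1 F.ι1 S) = F.B.map f * h1 + h0 * F.A.map f :=
  Iff.rfl

lemma isMF_map_iff {F : MF R} {f : R →+* S} {w : S} :
    (F.map f).IsMF w ↔ F.B.map f * F.A.map f = w • (1 : Matrix F.ι1 F.ι1 S) ∧
      F.A.map f * F.B.map f = w • (1 : Matrix F.ι0 F.ι0 S) :=
  Iff.rfl

lemma IsMF.map {w : R} {F : MF R} (h : F.IsMF w) (f : R →+* S) : (F.map f).IsMF (f w) := by
  rw [isMF_map_iff, ← Matrix.map_mul, ← Matrix.map_mul, h.1, h.2]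
  simp [smul_one_eq_diagonal, diagonal_map]

lemma Contractible.map {F : MF R} (h : F.Contractible) (f : R →+* S) :
    (F.map f).Contractible := by
  obtain ⟨h0, h1, e0, e1⟩ := h
  refine contractible_map_iff.2 ⟨h0.map f, h1.map f, ?_, ?_⟩
  · simp only [← Matrix.map_mul, ← Matrix.map_add f (map_add f), ← e0]
    simp
  · simp only [← Matrix.map_mul, ← Matrix.map_add f (map_add f), ← e1]
    simp

end Maps

section Tensor

variable {R : Type} [CommRing R]

lemma contractible_tensor_iff_exists {E F : MF R} :
    (E.tensor F).Contractible ↔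
      ∃ (H0 : Matrix ((E.ι1 × F.ι0) ⊕ (E.ι0 × F.ι1)) ((E.ι0 × F.ι0) ⊕ (E.ι1 × F.ι1)) R)
        (H1 : Matrix ((E.ι0 × F.ι0) ⊕ (E.ι1 × F.ι1)) ((E.ι1 × F.ι0) ⊕ (E.ι0 × F.ι1)) R),
        1 = fromBlocks (E.A ⊗ₖ 1) (1 ⊗ₖ F.A) (-(1 ⊗ₖ F.B)) (E.B ⊗ₖ 1) * H0 +
          H1 * fromBlocks (E.B ⊗ₖ 1) (-(1 ⊗ₖ F.A)) (1 ⊗ₖ F.B) (E.A ⊗ₖ 1) ∧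
        1 = fromBlocks (E.B ⊗ₖ 1) (-(1 ⊗ₖ F.A)) (1 ⊗ₖ F.B) (E.A ⊗ₖ 1) * H1 +
          H0 * fromBlocks (E.A ⊗ₖ 1) (1 ⊗ₖ F.A) (-(1 ⊗ₖ F.B)) (E.B ⊗ₖ 1) :=
  Iff.rfl

lemma Contractible.tensor_right {E : MF R} (h : E.Contractible) (F : MF R) :
    (E.tensor F).Contractible := by
  obtain ⟨h0, h1, e0, e1⟩ := h
  refine contractible_tensor_iff_exists.2
    ⟨fromBlocks (h0 ⊗ₖ 1) 0 0 (h1 ⊗ₖ 1), fromBlocks (h1 ⊗ₖ 1) 0 0 (h0 ⊗ₖ 1), ?_, ?_⟩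
  · simp [fromBlocks_multiply, fromBlocks_add, ← mul_kronecker_mul, ← add_kronecker,
      ← e0, ← e1]
  · simp [fromBlocks_multiply, fromBlocks_add, ← mul_kronecker_mul, ← add_kronecker,
      ← e0, ← e1]

lemma Contractible.tensor_left {F : MF R} (h : F.Contractible) (E : MF R) :
    (E.tensor F).Contractible := by
  obtain ⟨h0, h1, e0, e1⟩ := h
  refine contractible_tensor_iff_exists.2
    ⟨fromBlocks 0 (-(1 ⊗ₖ h1)) (1 ⊗ₖ h0) 0, fromBlocks 0 (1 ⊗ₖ h1) (-(1 ⊗ₖ h0)) 0, ?_, ?_⟩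
  · simp [fromBlocks_multiply, fromBlocks_add, ← mul_kronecker_mul, ← kronecker_add,
      ← e0, ← e1]
  · simp [fromBlocks_multiply, fromBlocks_add, ← mul_kronecker_mul, ← kronecker_add,
      ← e0, ← e1]

end Tensor

section Slices

variable {R : Type} [CommRing R] {m m' n n' : Type}

/-- The matrix of `ξ ⊗ id : R^m ⊗ R^n → R^n` for a linear form `ξ` on `R^m`. -/
def formTensor (n : Type) [DecidableEq n] (ξ : m → R) : Matrix n (m × n) R :=
  of fun j k => ξ k.1 * (1 : Matrix n n R) j k.2

/-- The matrix of `y ↦ x ⊗ y : R^n → R^m ⊗ R^n` for a vector `x` of `R^m`. -/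
def vecTensor (n : Type) [DecidableEq n] (x : m → R) : Matrix (m × n) n R :=
  of fun k j => x k.1 * (1 : Matrix n n R) k.2 j

@[simp] lemma formTensor_zero [DecidableEq n] : formTensor n (0 : m → R) = 0 := by
  ext; simp [formTensor]

@[simp] lemma vecTensor_zero [DecidableEq n] : vecTensor n (0 : m → R) = 0 := by
  ext; simp [vecTensor]

variable [Fintype m] [Fintype n] [DecidableEq n]

lemma formTensor_mul_kronecker_one (ξ : m → R) (A : Matrix m m' R) :
    formTensor n ξ * (A ⊗ₖ (1 : Matrix n n R)) = formTensor n (ξ ᵥ* A) := by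
  ext j k
  simp [formTensor, mul_apply, vecMul, dotProduct, Fintype.sum_prod_type, one_apply]

lemma formTensor_mul_one_kronecker [DecidableEq m] [Fintype n'] [DecidableEq n'] (ξ : m → R)
    (A : Matrix n n' R) :
    formTensor n ξ * ((1 : Matrix m m R) ⊗ₖ A) = A * formTensor n' ξ := by
  ext j k
  simp [formTensor, mul_apply, Fintype.sum_prod_type, one_apply, mul_comm]

lemma kronecker_one_mul_vecTensor (x : m → R) (A : Matrix m' m R) :
    (A ⊗ₖ (1 : Matrix n n R)) * vecTensor n x = vecTensor n (A *ᵥ x) := by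
  ext j k
  simp [vecTensor, mul_apply, mulVec, dotProduct, Fintype.sum_prod_type, one_apply]

lemma one_kronecker_mul_vecTensor [DecidableEq m] [Fintype n'] [DecidableEq n'] (x : m → R)
    (A : Matrix n' n R) :
    ((1 : Matrix m m R) ⊗ₖ A) * vecTensor n x = vecTensor n' x * A := by
  ext j k
  simp [vecTensor, mul_apply, Fintype.sum_prod_type, one_apply, mul_comm]

lemma formTensor_mul_vecTensor (ξ x : m → R) (h : ξ ⬝ᵥ x = 1) :
    formTensor n ξ * vecTensor n x = 1 := by
  ext j k
  by_cases hjk : j = k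
  · simpa [formTensor, vecTensor, mul_apply, Fintype.sum_prod_type, one_apply, hjk, dotProduct]
      using h
  · simp [formTensor, vecTensor, mul_apply, Fintype.sum_prod_type, one_apply, hjk]

/-- Sandwiching a homotopy identity on `R^m ⊗ R^n` between `ξ` and `x` yields one on `R^n`. -/
lemma one_eq_of_kronecker_homotopy {k : Type} [Fintype m'] [Fintype n'] [Fintype k]
    [DecidableEq m] [DecidableEq n'] {ξ x : m → R} (hξx : ξ ⬝ᵥ x = 1)
    {A : Matrix m m' R} {B : Matrix k m R} (hξ : ξ ᵥ* A = 0) (hx : B *ᵥ x = 0)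
    {C : Matrix n n' R} {D : Matrix n' n R} {H : Matrix (m' × n) (m × n) R}
    {H' : Matrix (m × n') (m × n) R} {K : Matrix (m × n) (k × n) R}
    {K' : Matrix (m × n) (m × n') R}
    (h : 1 = (A ⊗ₖ (1 : Matrix n n R)) * H + ((1 : Matrix m m R) ⊗ₖ C) * H' +
      (K * (B ⊗ₖ (1 : Matrix n n R)) + K' * ((1 : Matrix m m R) ⊗ₖ D))) :
    1 = C * (formTensor n' ξ * H' * vecTensor n x) +
      (formTensor n ξ * K' * vecTensor n' x) * D := by
  calc 1 = formTensor n ξ * (1 : Matrix (m × n) (m × n) R) * vecTensor n x := by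
        rw [Matrix.mul_one, formTensor_mul_vecTensor _ _ hξx]
    _ = (formTensor n ξ * (A ⊗ₖ (1 : Matrix n n R))) * H * vecTensor n x +
          (formTensor n ξ * ((1 : Matrix m m R) ⊗ₖ C)) * H' * vecTensor n x +
          (formTensor n ξ * K * ((B ⊗ₖ (1 : Matrix n n R)) * vecTensor n x) +
            formTensor n ξ * K' * (((1 : Matrix m m R) ⊗ₖ D) * vecTensor n x)) := by
        conv_lhs => rw [h]
        simp only [Matrix.mul_add, Matrix.add_mul, Matrix.mul_assoc]
    _ = _ := by
        rw [formTensor_mul_kronecker_one, formTensor_mul_one_kronecker,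
          kronecker_one_mul_vecTensor, one_kronecker_mul_vecTensor, hξ, hx]
        simp [Matrix.mul_assoc]

end Slices

section Retract

variable {R : Type} [CommRing R] {E F : MF R}

lemma fromBlocks_one_eq {m n : Type} [DecidableEq m] [DecidableEq n] {a : Matrix m m R}
    {b : Matrix m n R} {c : Matrix n m R} {d : Matrix n n R} (h : 1 = fromBlocks a b c d) :
    1 = a ∧ 1 = d := by
  rw [← fromBlocks_one, fromBlocks_inj] at h
  exact ⟨h.1, h.2.2.2⟩

/-- An even cycle `x` of `E` and a form `ξ` vanishing on boundaries with `ξ x = 1` make `F` a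
retract of `E ⊗ F`. -/
lemma Contractible.of_tensor_of_even (h : (E.tensor F).Contractible) (ξ x : E.ι0 → R)
    (hξ : ξ ᵥ* E.A = 0) (hx : E.B *ᵥ x = 0) (hξx : ξ ⬝ᵥ x = 1) : F.Contractible := by
  obtain ⟨H0, H1, e0, e1⟩ := contractible_tensor_iff_exists.1 h
  rw [← fromBlocks_toBlocks H0, ← fromBlocks_toBlocks H1] at e0 e1
  simp only [fromBlocks_multiply, fromBlocks_add] at e0 e1
  replace e0 := (fromBlocks_one_eq e0).1
  replace e1 := (fromBlocks_one_eq e1).2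
  rw [add_comm ((1 ⊗ₖ F.B) * _), add_comm (_ * (1 ⊗ₖ F.A))] at e1
  exact ⟨_, _, one_eq_of_kronecker_homotopy hξx hξ hx e0,
    one_eq_of_kronecker_homotopy hξx hξ hx e1⟩

/-- The analogue of `Contractible.of_tensor_of_even` for an odd cycle. -/
lemma Contractible.of_tensor_of_odd (h : (E.tensor F).Contractible) (ξ x : E.ι1 → R)
    (hξ : ξ ᵥ* E.B = 0) (hx : E.A *ᵥ x = 0) (hξx : ξ ⬝ᵥ x = 1) : F.Contractible := by
  obtain ⟨H0, H1, e0, e1⟩ := contractible_tensor_iff_exists.1 h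
  rw [← fromBlocks_toBlocks H0, ← fromBlocks_toBlocks H1] at e0 e1
  simp only [fromBlocks_multiply, fromBlocks_add] at e0 e1
  replace e0 := (fromBlocks_one_eq e0).2
  replace e1 := (fromBlocks_one_eq e1).1
  simp only [Matrix.neg_mul, Matrix.mul_neg] at e0 e1
  simp only [← Matrix.mul_neg _ (toBlocks₁₂ _), ← Matrix.mul_neg _ (toBlocks₂₁ _),
    ← Matrix.neg_mul] at e0 e1
  rw [add_comm ((1 ⊗ₖ F.B) * _), add_comm (_ * (1 ⊗ₖ F.A))] at e0
  exact ⟨_, _, one_eq_of_kronecker_homotopy hξx hξ hx e1,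
    one_eq_of_kronecker_homotopy hξx hξ hx e0⟩

end Retract

section Field

variable {K : Type} [Field K]

lemma exists_generalized_inverse {m n : Type} [Fintype m] [Fintype n] [DecidableEq m]
    [DecidableEq n] (A : Matrix m n K) : ∃ G : Matrix n m K, A * G * A = A := by
  obtain ⟨s, hs⟩ := (toLin' A).rangeRestrict.exists_rightInverse_of_surjective
    (LinearMap.range_rangeRestrict _)
  obtain ⟨g, hg⟩ := s.exists_extend
  refine ⟨LinearMap.toMatrix' g, toLin'.injective ?_⟩
  ext1 i
  ext1
  rw [toLin'_mul, toLin'_mul, toLin'_toMatrix']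
  have h1 := LinearMap.congr_fun hg ((toLin' A).rangeRestrict (Pi.single i 1))
  have h2 := congrArg Subtype.val
    (LinearMap.congr_fun hs ((toLin' A).rangeRestrict (Pi.single i 1)))
  simp only [LinearMap.comp_apply, LinearMap.id_apply, Submodule.subtype_apply,
    LinearMap.codRestrict_apply, LinearMap.rangeRestrict] at h1 h2
  simp only [LinearMap.comp_apply, LinearMap.single_apply]
  rw [h1]
  exact h2

/-- If `Q * P ≠ 0`, some row of `Q` and some column of `P` pair, after rescaling, to `1`. -/
lemma exists_dotProduct_eq_one {l m n k o : Type} [Fintype m] {Q : Matrix l m K}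
    {P : Matrix m n K} (h : Q * P ≠ 0) (B : Matrix m k K) (A : Matrix o m K)
    (hQ : Q * B = 0) (hP : A * P = 0) :
    ∃ ξ x : m → K, ξ ᵥ* B = 0 ∧ A *ᵥ x = 0 ∧ ξ ⬝ᵥ x = 1 := by
  obtain ⟨i, j, hij⟩ : ∃ i j, (Q * P) i j ≠ 0 := by
    by_contra! H
    exact h (ext H)
  refine ⟨((Q * P) i j)⁻¹ • Q i, fun a => P a j, ?_, ?_, ?_⟩
  · rw [smul_vecMul]
    have : Q i ᵥ* B = 0 := by
      ext a
      exact congrFun (congrFun hQ i) a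
    simp [this]
  · ext a
    exact congrFun (congrFun hP a) j
  · rw [smul_dotProduct]
    exact inv_mul_cancel₀ hij

lemma Contractible.or_of_tensor {E F : MF K} (hE : E.IsMF 0) (h : (E.tensor F).Contractible) :
    E.Contractible ∨ F.Contractible := by
  obtain ⟨hBA, hAB⟩ := hE
  rw [zero_smul] at hBA hAB
  obtain ⟨A', hA⟩ := exists_generalized_inverse E.A
  obtain ⟨B', hB⟩ := exists_generalized_inverse E.B
  by_cases h1 : (1 - E.B * B') * (1 - A' * E.A) = 0
  · by_cases h0 : (1 - E.A * A') * (1 - B' * E.B) = 0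
    · refine .inl ⟨(1 - E.B * B') * A', (1 - E.A * A') * B', ?_, ?_⟩
      · rw [← sub_eq_zero, ← h0]
        simp only [Matrix.mul_sub, Matrix.sub_mul, ← Matrix.mul_assoc, hAB, Matrix.zero_mul,
          Matrix.one_mul, Matrix.mul_one]
        abel
      · rw [← sub_eq_zero, ← h1]
        simp only [Matrix.mul_sub, Matrix.sub_mul, ← Matrix.mul_assoc, hBA, Matrix.zero_mul,
          Matrix.one_mul, Matrix.mul_one]
        abel
    · obtain ⟨ξ, x, hξ, hx, hξx⟩ := exists_dotProduct_eq_one h0 E.A E.B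
        (by simp [Matrix.sub_mul, hA]) (by simp [Matrix.mul_sub, ← Matrix.mul_assoc, hB])
      exact .inr (h.of_tensor_of_even ξ x hξ hx hξx)
  · obtain ⟨ξ, x, hξ, hx, hξx⟩ := exists_dotProduct_eq_one h1 E.B E.A
      (by simp [Matrix.sub_mul, hB]) (by simp [Matrix.mul_sub, ← Matrix.mul_assoc, hA])
    exact .inr (h.of_tensor_of_odd ξ x hξ hx hξx)

end Field

section Local

variable {S : Type} [CommRing S]

/-- A null-homotopic automorphism forces contractibility. -/
lemma IsMF.contractible_of_isUnit {w : S} {F : MF S} (hF : F.IsMF w) (h0 : Matrix F.ι1 F.ι0 S)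
    (h1 : Matrix F.ι0 F.ι1 S) (u0 : IsUnit (F.A * h0 + h1 * F.B))
    (u1 : IsUnit (F.B * h1 + h0 * F.A)) : F.Contractible := by
  obtain ⟨hBA, hAB⟩ := hF
  obtain ⟨g0, hg0⟩ := u0
  obtain ⟨g1, hg1⟩ := u1
  have cA : g0.val * F.A = F.A * g1.val := by
    rw [hg0, hg1]
    simp [Matrix.mul_add, Matrix.add_mul, Matrix.mul_assoc, hBA, ← Matrix.mul_assoc F.A F.B, hAB,
      add_comm]
  have cB : g1.val * F.B = F.B * g0.val := by
    rw [hg0, hg1]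
    simp [Matrix.mul_add, Matrix.add_mul, Matrix.mul_assoc, hAB, ← Matrix.mul_assoc F.B F.A, hBA,
      add_comm]
  have cB' : g1⁻¹.val * F.B = F.B * g0⁻¹.val := by
    calc g1⁻¹.val * F.B = g1⁻¹.val * (F.B * g0.val) * g0⁻¹.val := by
          simp [Matrix.mul_assoc]
      _ = (g1⁻¹.val * g1.val) * F.B * g0⁻¹.val := by rw [← cB]; simp only [Matrix.mul_assoc]
      _ = F.B * g0⁻¹.val := by simp
  have cA' : g0⁻¹.val * F.A = F.A * g1⁻¹.val := by
    calc g0⁻¹.val * F.A = g0⁻¹.val * (F.A * g1.val) * g1⁻¹.val := by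
          simp [Matrix.mul_assoc]
      _ = (g0⁻¹.val * g0.val) * F.A * g1⁻¹.val := by rw [← cA]; simp only [Matrix.mul_assoc]
      _ = F.A * g1⁻¹.val := by simp
  refine ⟨h0 * g0⁻¹.val, h1 * g1⁻¹.val, ?_, ?_⟩
  · rw [Matrix.mul_assoc h1, cB', ← Matrix.mul_assoc, ← Matrix.mul_assoc, ← Matrix.add_mul, ← hg0,
      Units.mul_inv]
  · rw [Matrix.mul_assoc h0, cA', ← Matrix.mul_assoc, ← Matrix.mul_assoc, ← Matrix.add_mul, ← hg1,
      Units.mul_inv]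

variable [IsLocalRing S]

lemma isUnit_of_map_residue_eq_one {n : Type} [Fintype n] [DecidableEq n] {M : Matrix n n S}
    (h : M.map (IsLocalRing.residue S) = 1) : IsUnit M := by
  rw [isUnit_iff_isUnit_det]
  apply isUnit_of_map_unit (IsLocalRing.residue S)
  rw [RingHom.map_det, RingHom.mapMatrix_apply, h, det_one]
  exact isUnit_one

lemma exists_map_residue_eq {m n : Type} (M : Matrix m n (IsLocalRing.ResidueField S)) :
    ∃ N : Matrix m n S, N.map (IsLocalRing.residue S) = M := by
  choose N hN using fun i j => IsLocalRing.residue_surjective (M i j)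
  exact ⟨of N, ext hN⟩

lemma IsMF.contractible_of_residue {w : S} {F : MF S} (hF : F.IsMF w)
    (h : (F.map (IsLocalRing.residue S)).Contractible) : F.Contractible := by
  obtain ⟨k0, k1, e0, e1⟩ := contractible_map_iff.1 h
  obtain ⟨h0, rfl⟩ := exists_map_residue_eq k0
  obtain ⟨h1, rfl⟩ := exists_map_residue_eq k1
  refine hF.contractible_of_isUnit h0 h1 (isUnit_of_map_residue_eq_one ?_)
    (isUnit_of_map_residue_eq_one ?_)
  · rw [Matrix.map_add _ (map_add _), Matrix.map_mul, Matrix.map_mul]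
    exact e0.symm
  · rw [Matrix.map_add _ (map_add _), Matrix.map_mul, Matrix.map_mul]
    exact e1.symm

lemma contractible_tensor_iff {v w : S} {E F : MF S} (hE : E.IsMF v) (hF : F.IsMF w)
    (hv : v ∈ IsLocalRing.maximalIdeal S) :
    (E.tensor F).Contractible ↔ E.Contractible ∨ F.Contractible := by
  refine ⟨fun h => ?_, fun h => h.elim (·.tensor_right F) (·.tensor_left E)⟩
  have h' := h.map (IsLocalRing.residue S)
  rw [map_tensor] at h'
  have hE' := hE.map (IsLocalRing.residue S)
  rw [(IsLocalRing.residue_eq_zero_iff v).2 hv] at hE'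
  exact (Contractible.or_of_tensor hE' h').imp hE.contractible_of_residue
    hF.contractible_of_residue

end Local

end MF

theorem stmt15 (R : Type) [CommRing R] (v w : R)
    (E F : MF R) (hE : E.IsMF v) (hF : F.IsMF w)
    (p : PrimeSpectrum R) (hv : v ∈ p.asIdeal) (hw : w ∈ p.asIdeal) :
    p ∈ (E.tensor F).Supp ↔ p ∈ E.Supp ∧ p ∈ F.Supp := by
  have hv' : algebraMap R (Localization.AtPrime p.asIdeal) v ∈
      IsLocalRing.maximalIdeal (Localization.AtPrime p.asIdeal) :=
    (IsLocalization.AtPrime.to_map_mem_maximal_iff _ p.asIdeal v).2 hv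
  simp only [MF.Supp, Set.mem_ofPred_eq]
  rw [MF.map_tensor, MF.contractible_tensor_iff (hE.map _) (hF.map _) hv', not_or]
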